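/- arXiv:0809.1176 — 2 statements merged into one kernel-verified Lean document; each statement's English description precedes it below -/
import Mathlib

section
/- Let E be a real Banach space, X ⊆ E a finite-dimensional subspace with closed complement Y, and suppose every bounded projection on E with n-dimensional range (n = dim X) is conjugate to the projection p onto X along Y. If additionally the conjugacy class of p is path connected in the idempotents, then every invertible operator T ∈ GL(E) is connected by a continuous path in GL(E) to an operator of the form A ⊕ S, where A ∈ GL(X) and S ∈ GL(Y). -/
open Filter Topology unitInterval

/-- Idempotents close to a given one are conjugate to it by a unit in the path component of `1`. -/
theorem eventually_exists_pathComponentOne_conj {R : Type*} [NormedRing R] [NormedAlgebra ℝ R]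
    [CompleteSpace R] {q : R} (hq : q * q = q) :
    ∀ᶠ r in 𝓝 q, r * r = r → ∃ u ∈ Subgroup.pathComponentOne Rˣ, (u : R) * q = r * u := by
  have : LocallyPathConnectedSpace Rˣ := Units.isOpenEmbedding_val.locallyPathConnectedSpace
  have hmem : (Units.val '' pathComponent (1 : Rˣ) : Set R) ∈ 𝓝 (1 : R) := by
    have h := (Units.isOpenEmbedding_val (R := R)).isOpenMap.image_mem_nhds
      ((IsOpen.pathComponent (1 : Rˣ)).mem_nhds (mem_pathComponent_self 1))
    simpa using h
  have hcont : Tendsto (fun r : R ↦ r * q + (1 - r) * (1 - q)) (𝓝 q) (𝓝 1) := by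
    have h : Continuous fun r : R ↦ r * q + (1 - r) * (1 - q) := by fun_prop
    convert h.tendsto q using 2
    simp only [mul_sub, sub_mul, hq, one_mul, mul_one]
    abel
  filter_upwards [hcont hmem] with r hr hrr
  obtain ⟨u, hu, huv⟩ := hr
  refine ⟨u, hu, ?_⟩
  rw [huv]
  simp only [mul_sub, sub_mul, mul_add, add_mul, mul_assoc, hq, one_mul, mul_one]
  simp only [← mul_assoc, hrr]
  abel

/-- Idempotents joined by a path of idempotents are conjugate by a unit in the path component
of `1`. -/
theorem JoinedIn.exists_pathComponentOne_conj {R : Type*} [NormedRing R] [NormedAlgebra ℝ R]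
    [CompleteSpace R] {q r : R} (h : JoinedIn {x : R | x * x = x} q r) :
    ∃ u ∈ Subgroup.pathComponentOne Rˣ, (u : R) * q = r * u := by
  obtain ⟨γ, hγ⟩ := h
  let P : I → I → Prop := fun s t ↦ ∃ u ∈ Subgroup.pathComponentOne Rˣ, (u : R) * γ s = γ t * u
  have : Std.Symm P := ⟨fun s t ⟨u, hu, h⟩ ↦ ⟨u⁻¹, inv_mem hu, by
    rw [Units.inv_mul_eq_iff_eq_mul, ← mul_assoc, h, Units.mul_inv_cancel_right]⟩⟩
  have hP : IsTrans I P := ⟨fun s t v ⟨a, ha, h⟩ ⟨b, hb, h'⟩ ↦ ⟨b * a, mul_mem hb ha, by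
    rw [Units.val_mul, mul_assoc, h, ← mul_assoc, h', mul_assoc]⟩⟩
  have h01 : P 0 1 := PreconnectedSpace.induction₂ P (fun s ↦ by
    filter_upwards [γ.continuous.continuousAt.eventually
      (eventually_exists_pathComponentOne_conj (hγ s))] with t ht
    exact ht (hγ t)) hP 0 1
  simpa [P] using h01

section ProdMap

variable {𝕜 X Y : Type*} [NontriviallyNormedField 𝕜]
  [NormedAddCommGroup X] [NormedSpace 𝕜 X] [NormedAddCommGroup Y] [NormedSpace 𝕜 Y]

/-- An operator commuting with the projection onto the first factor is block diagonal. -/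
theorem ContinuousLinearMap.eq_prodMap_of_commute {f : (X × Y) →L[𝕜] (X × Y)}
    (hf : Commute f ((ContinuousLinearMap.id 𝕜 X).prodMap (0 : Y →L[𝕜] Y))) :
    f = ((fst 𝕜 X Y).comp (f.comp (inl 𝕜 X Y))).prodMap
      ((snd 𝕜 X Y).comp (f.comp (inr 𝕜 X Y))) := by
  have h (z : X × Y) : f (z.1, 0) = ((f z).1, 0) := by
    simpa [Prod.map] using DFunLike.congr_fun hf.eq z
  refine ContinuousLinearMap.ext fun z ↦ ?_
  have hz : f z = f (z.1, 0) + f (0, z.2) := by rw [← map_add]; simp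
  have h₁ := congrArg Prod.snd (h z)
  have h₂ := congrArg Prod.fst (h (0, z.2))
  simp only [Prod.mk_zero_zero, map_zero, Prod.fst_zero] at h₁ h₂
  refine Prod.ext ?_ ?_
  · simp [hz, ← h₂]
  · simp [hz, h₁]

/-- An invertible operator commuting with the projection onto the first factor is block diagonal
with invertible blocks. -/
theorem ContinuousLinearMap.exists_units_eq_prodMap {s : ((X × Y) →L[𝕜] (X × Y))ˣ}
    (hs : Commute (s : (X × Y) →L[𝕜] (X × Y))
      ((ContinuousLinearMap.id 𝕜 X).prodMap (0 : Y →L[𝕜] Y))) :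
    ∃ (A : (X →L[𝕜] X)ˣ) (S : (Y →L[𝕜] Y)ˣ),
      (s : (X × Y) →L[𝕜] (X × Y)) = (A : X →L[𝕜] X).prodMap (S : Y →L[𝕜] Y) := by
  have prodMap_eq_one {A A' : X →L[𝕜] X} {S S' : Y →L[𝕜] Y}
      (h : A.prodMap S * A'.prodMap S' = 1) : A * A' = 1 ∧ S * S' = 1 := by
    constructor <;> ext v
    · simpa using congrArg Prod.fst (DFunLike.congr_fun h (v, 0))
    · simpa using congrArg Prod.snd (DFunLike.congr_fun h (0, v))
  have h₁ := eq_prodMap_of_commute hs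
  have h₂ := eq_prodMap_of_commute hs.units_inv_left
  have h := s.mul_inv
  have h' := s.inv_mul
  rw [h₁, h₂] at h h'
  exact ⟨⟨_, _, (prodMap_eq_one h).1, (prodMap_eq_one h').1⟩,
    ⟨_, _, (prodMap_eq_one h).2, (prodMap_eq_one h').2⟩, h₁⟩

end ProdMap

theorem stmt11 {X Y : Type*} [NormedAddCommGroup X] [NormedSpace ℝ X]
    [FiniteDimensional ℝ X]
    [NormedAddCommGroup Y] [NormedSpace ℝ Y] [CompleteSpace Y]
    (p : (X × Y) →L[ℝ] (X × Y))
    (hp : p = (ContinuousLinearMap.id ℝ X).prodMap (0 : Y →L[ℝ] Y))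
    (hconj : ∀ q : (X × Y) →L[ℝ] (X × Y), q * q = q →
      Module.finrank ℝ (LinearMap.range (q : (X × Y) →ₗ[ℝ] (X × Y))) = Module.finrank ℝ X →
      ∃ t : ((X × Y) →L[ℝ] (X × Y))ˣ,
        (t : (X × Y) →L[ℝ] (X × Y)) * p * (↑t⁻¹ : (X × Y) →L[ℝ] (X × Y)) = q)
    (hpath : ∀ t : ((X × Y) →L[ℝ] (X × Y))ˣ,
      JoinedIn {r : (X × Y) →L[ℝ] (X × Y) | r * r = r} p
        ((t : (X × Y) →L[ℝ] (X × Y)) * p * (↑t⁻¹ : (X × Y) →L[ℝ] (X × Y)))) :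
    ∀ T : ((X × Y) →L[ℝ] (X × Y))ˣ,
      ∃ (A : (X →L[ℝ] X)ˣ) (S : (Y →L[ℝ] Y)ˣ) (s : ((X × Y) →L[ℝ] (X × Y))ˣ),
        (s : (X × Y) →L[ℝ] (X × Y)) = (A : X →L[ℝ] X).prodMap (S : Y →L[ℝ] Y) ∧
        Joined T s := by
  intro T
  have : CompleteSpace X := FiniteDimensional.complete ℝ X
  obtain ⟨u, hu, hup⟩ := (hpath T).exists_pathComponentOne_conj
  have hcomm : Commute ((u⁻¹ * T : ((X × Y) →L[ℝ] (X × Y))ˣ) : (X × Y) →L[ℝ] (X × Y)) p := by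
    have hTp : (T : (X × Y) →L[ℝ] (X × Y)) * p = u * p * (↑u⁻¹ * T) := by
      rw [hup]
      simp [mul_assoc]
    rw [Commute, SemiconjBy, Units.val_mul, mul_assoc, Units.inv_mul_eq_iff_eq_mul, hTp, mul_assoc]
  obtain ⟨A, S, hs⟩ := ContinuousLinearMap.exists_units_eq_prodMap (hp ▸ hcomm)
  refine ⟨A, S, u⁻¹ * T, hs, ?_⟩
  have hu' : Joined 1 u⁻¹ := inv_mem hu
  simpa using hu'.mul (Joined.refl T)
end

section
/- Let E = X ⊕ Y be a Banach space, p the projection onto X along Y. The set of t ∈ GL(E) such that t·p·t⁻¹ lies in the path component of p in the idempotents is exactly the union of those path components of GL(E) that meet the image of the embedding GL(X) × GL(Y) → GL(E), (x,y) ↦ x ⊕ y. -/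
/-- In a complete normed ring, the intertwiner `r * q + (1 - r) * (1 - q)` between nearby
idempotents lies in the path component of `1` in the unit group. -/
theorem eventually_conj_of_idempotent {R : Type*} [NormedRing R] [NormedAlgebra ℝ R]
    [CompleteSpace R] {T : Type*} [TopologicalSpace T] {e : T → R} (hc : Continuous e)
    (he : ∀ a, e a * e a = e a) (a : T) :
    ∀ᶠ b in nhds a, ∃ g : Rˣ, Joined 1 g ∧ (g : R) * e a = e b * g := by
  have : LocallyPathConnectedSpace Rˣ := Units.isOpenEmbedding_val.locallyPathConnectedSpace
  have ho : IsOpen (Units.val '' pathComponent (1 : Rˣ)) :=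
    Units.isOpenEmbedding_val.isOpenMap _ (IsOpen.pathComponent 1)
  have hu : Continuous fun b => e b * e a + (1 - e b) * (1 - e a) := by fun_prop
  have h1 : e a * e a + (1 - e a) * (1 - e a) = 1 := by
    have := he a
    simp only [mul_sub, sub_mul, mul_one, one_mul, this]
    abel
  have hm : Units.val '' pathComponent (1 : Rˣ) ∈
      nhds (e a * e a + (1 - e a) * (1 - e a)) := by
    rw [h1]
    exact ho.mem_nhds ⟨1, mem_pathComponent_self 1, rfl⟩
  filter_upwards [hu.continuousAt.preimage_mem_nhds hm] with b hb
  obtain ⟨g, hg, hgb⟩ := hb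
  refine ⟨g, hg, ?_⟩
  have ha := he a
  have hb := he b
  rw [hgb]
  simp only [mul_sub, sub_mul, mul_one, one_mul, mul_add, add_mul, mul_assoc, ha]
  simp only [← mul_assoc, hb]
  abel

/-- Idempotents in the same path component are conjugate by a unit joined to `1`. -/
theorem JoinedIn.exists_conj_of_idempotent {R : Type*} [NormedRing R] [NormedAlgebra ℝ R]
    [CompleteSpace R] {p q : R} (h : JoinedIn {r : R | r * r = r} p q) :
    ∃ g : Rˣ, Joined 1 g ∧ (g : R) * p = q * g := by
  obtain ⟨γ, hγ⟩ := h
  let P (a b : unitInterval) : Prop := ∃ g : Rˣ, Joined 1 g ∧ (g : R) * γ a = γ b * g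
  have : Std.Symm P := by
    refine ⟨?_⟩
    rintro a b ⟨g, hg, hgab⟩
    refine ⟨g⁻¹, by simpa using hg.inv, ?_⟩
    rw [Units.inv_mul_eq_iff_eq_mul, ← mul_assoc, hgab, Units.mul_inv_cancel_right]
  have htrans : IsTrans unitInterval P := by
    refine ⟨?_⟩
    rintro a b c ⟨g, hg, hgab⟩ ⟨k, hk, hkbc⟩
    refine ⟨k * g, by simpa using hk.mul hg, ?_⟩
    rw [Units.val_mul, mul_assoc, hgab, ← mul_assoc, hkbc, mul_assoc]
  simpa [P] using PreconnectedSpace.induction₂ P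
    (eventually_conj_of_idempotent γ.continuous hγ) htrans 0 1

/-- An invertible operator commuting with the projection onto `X` along `Y` is block diagonal. -/
theorem exists_prodMap_eq_of_commute {X Y : Type*} [NormedAddCommGroup X] [NormedSpace ℝ X]
    [NormedAddCommGroup Y] [NormedSpace ℝ Y] (s : ((X × Y) →L[ℝ] (X × Y))ˣ)
    (hs : Commute (s : (X × Y) →L[ℝ] (X × Y))
      ((ContinuousLinearMap.id ℝ X).prodMap (0 : Y →L[ℝ] Y))) :
    ∃ (x : (X →L[ℝ] X)ˣ) (y : (Y →L[ℝ] Y)ˣ),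
      (s : (X × Y) →L[ℝ] (X × Y)) = (x : X →L[ℝ] X).prodMap (y : Y →L[ℝ] Y) := by
  have hfst (c : (X × Y) →L[ℝ] (X × Y))
      (hc : Commute c ((ContinuousLinearMap.id ℝ X).prodMap (0 : Y →L[ℝ] Y))) (x : X) :
      (c (x, 0)).2 = 0 := by
    simpa using congrArg Prod.snd (DFunLike.congr_fun hc.eq (x, (0 : Y)))
  have hsnd (c : (X × Y) →L[ℝ] (X × Y))
      (hc : Commute c ((ContinuousLinearMap.id ℝ X).prodMap (0 : Y →L[ℝ] Y))) (y : Y) :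
      (c (0, y)).1 = 0 := by
    have h := congrArg Prod.fst (DFunLike.congr_fun hc.eq ((0 : X), y))
    have h0 : c (0, 0) = 0 := map_zero c
    simpa [h0] using h.symm
  have hfst' (c : (X × Y) →L[ℝ] (X × Y))
      (hc : Commute c ((ContinuousLinearMap.id ℝ X).prodMap (0 : Y →L[ℝ] Y))) (x : X) :
      ((c (x, 0)).1, (0 : Y)) = c (x, 0) := Prod.ext rfl (hfst c hc x).symm
  have hsnd' (c : (X × Y) →L[ℝ] (X × Y))
      (hc : Commute c ((ContinuousLinearMap.id ℝ X).prodMap (0 : Y →L[ℝ] Y))) (y : Y) :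
      ((0 : X), (c (0, y)).2) = c (0, y) := Prod.ext (hsnd c hc y).symm rfl
  have hi := hs.units_inv_left
  have hl (v : X × Y) : (↑s⁻¹ : (X × Y) →L[ℝ] (X × Y)) ((s : (X × Y) →L[ℝ] (X × Y)) v) = v :=
    DFunLike.congr_fun s.inv_mul v
  have hr (v : X × Y) : (s : (X × Y) →L[ℝ] (X × Y)) ((↑s⁻¹ : (X × Y) →L[ℝ] (X × Y)) v) = v :=
    DFunLike.congr_fun s.mul_inv v
  let f (c : (X × Y) →L[ℝ] (X × Y)) : X →L[ℝ] X :=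
    (ContinuousLinearMap.fst ℝ X Y).comp (c.comp (ContinuousLinearMap.inl ℝ X Y))
  let g (c : (X × Y) →L[ℝ] (X × Y)) : Y →L[ℝ] Y :=
    (ContinuousLinearMap.snd ℝ X Y).comp (c.comp (ContinuousLinearMap.inr ℝ X Y))
  refine ⟨⟨f s, f ↑s⁻¹, ?_, ?_⟩, ⟨g s, g ↑s⁻¹, ?_, ?_⟩, ?_⟩
  · ext x
    simp [f, hfst' _ hi, hr]
  · ext x
    simp [f, hfst' _ hs, hl]
  · ext y
    simp [g, hsnd' _ hi, hr]
  · ext y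
    simp [g, hsnd' _ hs, hl]
  · ext v <;> simp [f, g, hfst _ hs, hsnd _ hs]


theorem stmt15 {X Y : Type*} [NormedAddCommGroup X] [NormedSpace ℝ X] [CompleteSpace X]
    [NormedAddCommGroup Y] [NormedSpace ℝ Y] [CompleteSpace Y]
    (p : (X × Y) →L[ℝ] (X × Y))
    (hp : p = (ContinuousLinearMap.id ℝ X).prodMap (0 : Y →L[ℝ] Y)) :
    {t : ((X × Y) →L[ℝ] (X × Y))ˣ |
        JoinedIn {r : (X × Y) →L[ℝ] (X × Y) | r * r = r} p
          ((t : (X × Y) →L[ℝ] (X × Y)) * p * (↑t⁻¹ : (X × Y) →L[ℝ] (X × Y)))} =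
      {t : ((X × Y) →L[ℝ] (X × Y))ˣ |
        ∃ (x : (X →L[ℝ] X)ˣ) (y : (Y →L[ℝ] Y)ˣ) (s : ((X × Y) →L[ℝ] (X × Y))ˣ),
          (s : (X × Y) →L[ℝ] (X × Y)) = (x : X →L[ℝ] X).prodMap (y : Y →L[ℝ] Y) ∧
          Joined t s} := by
  have hpp : p * p = p := by
    subst hp
    ext v <;> simp
  ext t
  constructor
  · intro h
    obtain ⟨g, hg, hgt⟩ := JoinedIn.exists_conj_of_idempotent h
    have hcomm : Commute (↑(g⁻¹ * t) : (X × Y) →L[ℝ] (X × Y)) p := by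
      have h1 : (t : (X × Y) →L[ℝ] (X × Y)) * p = g * p * ↑g⁻¹ * t := by
        rw [hgt]
        simp [mul_assoc]
      rw [Commute, SemiconjBy, Units.val_mul, mul_assoc, h1]
      simp [← mul_assoc]
    rw [hp] at hcomm
    obtain ⟨x, y, hxy⟩ := exists_prodMap_eq_of_commute _ hcomm
    refine ⟨x, y, g⁻¹ * t, hxy, ?_⟩
    simpa using (hg.inv.mul (Joined.refl t))
  · rintro ⟨x, y, s, hs, ⟨γ⟩⟩
    have hsp : (s : (X × Y) →L[ℝ] (X × Y)) * p = p * s := by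
      rw [hs, hp]
      ext v <;> simp
    refine JoinedIn.symm ⟨⟨⟨fun a => (γ a : (X × Y) →L[ℝ] (X × Y)) * p *
      (↑(γ a)⁻¹ : (X × Y) →L[ℝ] (X × Y)), ?_⟩, ?_, ?_⟩, ?_⟩
    · have h1 : Continuous fun a => (γ a : (X × Y) →L[ℝ] (X × Y)) :=
        Units.continuous_val.comp γ.continuous
      have h2 : Continuous fun a => (↑(γ a)⁻¹ : (X × Y) →L[ℝ] (X × Y)) :=
        Units.continuous_val.comp γ.continuous.inv
      exact (h1.mul continuous_const).mul h2
    · simp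
    · simp [hsp, mul_assoc]
    · intro a
      change _ * _ = _
      simp only [Path.coe_mk_mk, mul_assoc, Units.inv_mul_cancel_left]
      rw [← mul_assoc p p, hpp]
end
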